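/- arXiv:1905.04273 — 8 statements merged into one kernel-verified Lean document; each statement's English description precedes it below -/
import Mathlib

section
/- Let Y be a finite nonempty set, ε > 0, Δ > 0, and let a, b : Y → ℝ satisfy |a(y) − b(y)| ≤ Δ for all y ∈ Y. Define probability mass functions p(y) = exp((ε/Δ)·a(y)) / ∑_{z∈Y} exp((ε/Δ)·a(z)) and q(y) = exp((ε/Δ)·b(y)) / ∑_{z∈Y} exp((ε/Δ)·b(z)). Then for all y, y' ∈ Y we have p(y)·q(y') ≤ e^{2ε}·q(y)·p(y'). (The exponential mechanism with a sensitivity-Δ quality score is 2ε-range-bounded.) -/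
open scoped BigOperators

/-- The exponential mechanism with a sensitivity-`Δ` quality score is `2ε`-range-bounded. -/
theorem stmt_0 {Y : Type*} [Fintype Y] [Nonempty Y] (ε Δ : ℝ) (hε : 0 < ε) (hΔ : 0 < Δ)
    (a b : Y → ℝ) (hab : ∀ y, |a y - b y| ≤ Δ) (y y' : Y) :
    (Real.exp ((ε / Δ) * a y) / ∑ z, Real.exp ((ε / Δ) * a z)) *
      (Real.exp ((ε / Δ) * b y') / ∑ z, Real.exp ((ε / Δ) * b z)) ≤
    Real.exp (2 * ε) *
      ((Real.exp ((ε / Δ) * b y) / ∑ z, Real.exp ((ε / Δ) * b z)) *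
        (Real.exp ((ε / Δ) * a y') / ∑ z, Real.exp ((ε / Δ) * a z))) := by
  have hexp : ε / Δ * a y + ε / Δ * b y' ≤ 2 * ε + (ε / Δ * b y + ε / Δ * a y') := by
    have hy := (abs_le.mp (hab y)).2
    have hy' := (abs_le.mp (hab y')).1
    have hmul : ε / Δ * ((a y - b y) - (a y' - b y')) ≤ ε / Δ * (2 * Δ) :=
      mul_le_mul_of_nonneg_left (by linarith) (by positivity)
    have hcancel : ε / Δ * (2 * Δ) = 2 * ε := by
      field_simp
    linarith
  rw [div_mul_div_comm, div_mul_div_comm,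
    mul_comm (∑ z, Real.exp (ε / Δ * b z)), ← mul_div_assoc]
  refine div_le_div_of_nonneg_right ?_ (by positivity)
  simpa only [← Real.exp_add] using Real.exp_le_exp.mpr hexp
end

section
/- Let Y be a finite nonempty set, ε > 0, Δ > 0, and let a, b : Y → ℝ satisfy b(y) ≤ a(y) ≤ b(y) + Δ for all y ∈ Y (monotone quality score). Define p(y) = exp((ε/Δ)·a(y)) / ∑_{z∈Y} exp((ε/Δ)·a(z)) and q(y) = exp((ε/Δ)·b(y)) / ∑_{z∈Y} exp((ε/Δ)·b(z)). Then for all y, y' ∈ Y we have p(y)·q(y') ≤ e^{ε}·q(y)·p(y'). (The exponential mechanism with a monotone sensitivity-Δ quality score is ε-range-bounded.) -/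
open scoped BigOperators

/-- The exponential mechanism with a monotone sensitivity-`Δ` quality score is
`ε`-range-bounded. -/
theorem stmt_1 {Y : Type*} [Fintype Y] [Nonempty Y] (ε Δ : ℝ) (hε : 0 < ε) (hΔ : 0 < Δ)
    (a b : Y → ℝ) (hab : ∀ y, b y ≤ a y ∧ a y ≤ b y + Δ) (y y' : Y) :
    (Real.exp ((ε / Δ) * a y) / ∑ z, Real.exp ((ε / Δ) * a z)) *
      (Real.exp ((ε / Δ) * b y') / ∑ z, Real.exp ((ε / Δ) * b z)) ≤
    Real.exp ε *
      ((Real.exp ((ε / Δ) * b y) / ∑ z, Real.exp ((ε / Δ) * b z)) *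
        (Real.exp ((ε / Δ) * a y') / ∑ z, Real.exp ((ε / Δ) * a z))) := by
  have key : (ε / Δ) * a y + (ε / Δ) * b y' ≤ ε + ((ε / Δ) * b y + (ε / Δ) * a y') := by
    have hc : 0 < ε / Δ := div_pos hε hΔ
    have hcΔ : ε / Δ * Δ = ε := div_mul_cancel₀ ε hΔ.ne'
    have h₁ := mul_le_mul_of_nonneg_left (hab y).2 hc.le
    have h₂ := mul_le_mul_of_nonneg_left (hab y').1 hc.le
    linarith
  rw [div_mul_div_comm, div_mul_div_comm, ← mul_div_assoc,
    mul_comm (∑ z, Real.exp ((ε / Δ) * b z)), ← Real.exp_add, ← Real.exp_add, ← Real.exp_add]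
  gcongr
end

section
/- Let p and q be probability mass functions on a countable set Y with q(y) > 0 whenever p(y) > 0. (i) If p(y)·q(y') ≤ e^{ε}·q(y)·p(y') for all y, y' ∈ Y, then p(y) ≤ e^{ε}·q(y) for all y ∈ Y. (ii) Conversely, if p(y) ≤ e^{ε}·q(y) and q(y) ≤ e^{ε}·p(y) for all y ∈ Y, then p(y)·q(y') ≤ e^{2ε}·q(y)·p(y') for all y, y'. (iii) Under the hypothesis of (i), with all p(y), q(y) > 0, sup_{y∈Y} log(p(y)/q(y)) − inf_{y'∈Y} log(p(y')/q(y')) ≤ ε. -/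
/-- Relations between range-boundedness and the pointwise ε-DP likelihood-ratio bound:
(i) ε-range-bounded implies the pointwise ε-DP bound; (ii) the two-sided pointwise ε-DP
bound implies 2ε-range-boundedness; (iii) ε-range-bounded bounds the width of the range
of the log-likelihood ratio by ε. -/
theorem stmt_2 {Y : Type*} [Countable Y] (ε : ℝ) (p q : Y → ℝ)
    (hp0 : ∀ y, 0 ≤ p y) (hq0 : ∀ y, 0 ≤ q y)
    (hp1 : HasSum p 1) (hq1 : HasSum q 1)
    (hpq : ∀ y, 0 < p y → 0 < q y) :
    ((∀ y y' : Y, p y * q y' ≤ Real.exp ε * (q y * p y')) →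
        ∀ y, p y ≤ Real.exp ε * q y) ∧
    ((∀ y, p y ≤ Real.exp ε * q y) → (∀ y, q y ≤ Real.exp ε * p y) →
        ∀ y y' : Y, p y * q y' ≤ Real.exp (2 * ε) * (q y * p y')) ∧
    ((∀ y y' : Y, p y * q y' ≤ Real.exp ε * (q y * p y')) →
      (∀ y, 0 < p y) → (∀ y, 0 < q y) →
        (⨆ y : Y, Real.log (p y / q y)) - (⨅ y' : Y, Real.log (p y' / q y')) ≤ ε) := by
  refine ⟨fun h y => ?_, fun h h' y y' => ?_, fun h hp hq => ?_⟩
  · have hle := hasSum_le (fun y' => h y y') (hq1.mul_left (p y))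
      ((hp1.mul_left (q y)).mul_left (Real.exp ε))
    simpa using hle
  · calc p y * q y' ≤ (Real.exp ε * q y) * (Real.exp ε * p y') :=
          mul_le_mul (h y) (h' y') (hq0 y') (mul_nonneg (Real.exp_pos ε).le (hq0 y))
      _ = Real.exp (2 * ε) * (q y * p y') := by
          rw [two_mul, Real.exp_add]; ring
  · have hY : Nonempty Y := by
      by_contra hY
      rw [not_nonempty_iff] at hY
      exact zero_ne_one (hasSum_empty.unique hp1)
    have hlog : ∀ y y', Real.log (p y / q y) - ε ≤ Real.log (p y' / q y') := by
      intro y y'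
      have hl := Real.log_le_log (mul_pos (hp y) (hq y')) (h y y')
      rw [Real.log_mul (hp y).ne' (hq y').ne',
        Real.log_mul (Real.exp_pos ε).ne' (mul_pos (hq y) (hp y')).ne',
        Real.log_mul (hq y).ne' (hp y').ne', Real.log_exp] at hl
      rw [Real.log_div (hp y).ne' (hq y).ne', Real.log_div (hp y').ne' (hq y').ne']
      linarith
    rw [sub_le_iff_le_add]
    exact ciSup_le fun y => sub_le_iff_le_add'.mp (le_ciInf (hlog y))
end

section
/- Fix two inputs x, x', an integer t ≥ 1, countable outcome sets Y_1, …, Y_t, and adaptively chosen mechanisms M_1, …, M_t, where M_i maps an input together with a history (y_1, …, y_{i−1}) ∈ Y_1 × ⋯ × Y_{i−1} to a probability mass function on Y_i. Suppose each M_i is ε_i-range-bounded with respect to x, x' for every history v, i.e. P[M_i(x,v)=y]·P[M_i(x',v)=y'] ≤ e^{ε_i}·P[M_i(x',v)=y]·P[M_i(x,v)=y'] for all y, y' ∈ Y_i. Let M(x) denote the distribution on Y_1 × ⋯ × Y_t obtained by sampling y_1 ∼ M_1(x) and then y_i ∼ M_i(x,(y_1,…,y_{i−1})) sequentially. Then for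 every δ ∈ (0,1) and every S ⊆ Y_1 × ⋯ × Y_t: P[M(x) ∈ S] ≤ e^{ε''}·P[M(x') ∈ S] + δ, where ε'' = min{ ∑_{i=1}^t ε_i, ∑_{i=1}^t ε_i·(e^{ε_i}−1)/(e^{ε_i}+1) + √(2·∑_{i=1}^t ε_i²·ln(1/δ)), ∑_{i=1}^t ε_i²/2 + √((1/2)·∑_{i=1}^t ε_i²·ln(1/δ)) }. -/
open scoped BigOperators

section SingleStep

variable {α : Type*}

/-- **Hoeffding's lemma** for a discrete distribution. -/
lemma tsum_mul_exp_le_of_mem_Icc [Countable α] {p L : α → ℝ} {a b : ℝ}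
    (hp0 : ∀ y, 0 ≤ p y) (hp1 : HasSum p 1) (hL : ∀ y, L y ∈ Set.Icc a b) (l : ℝ) :
    ∑' y, ENNReal.ofReal (p y * Real.exp (l * L y)) ≤
      ENNReal.ofReal (Real.exp (l * ∑' y, p y * L y + l ^ 2 * (b - a) ^ 2 / 8)) := by
  let _ : MeasurableSpace α := ⊤
  let π : PMF α := ⟨fun y => ENNReal.ofReal (p y), by
    rw [ENNReal.summable.hasSum_iff, ← ENNReal.ofReal_tsum_of_nonneg hp0 hp1.summable,
      hp1.tsum_eq, ENNReal.ofReal_one]⟩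
  have hπ (y : α) : π y = ENNReal.ofReal (p y) := rfl
  have hm : AEMeasurable L π.toMeasure := (Measurable.of_discrete).aemeasurable
  have hb : ∀ᵐ y ∂π.toMeasure, L y ∈ Set.Icc a b := Filter.Eventually.of_forall hL
  have hint : ∫ y, L y ∂π.toMeasure = ∑' y, p y * L y := by
    rw [PMF.integral_eq_tsum _ _ (MeasureTheory.Integrable.of_mem_Icc a b hm hb)]
    simp [hπ, ENNReal.toReal_ofReal (hp0 _)]
  have hmgf := (ProbabilityTheory.hasSubgaussianMGF_of_mem_Icc hm hb).mgf_le l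
  simp only [hint, ProbabilityTheory.mgf, mul_sub, sub_eq_add_neg (l * _), Real.exp_add,
    MeasureTheory.integral_mul_const] at hmgf
  have hexp : MeasureTheory.Integrable (fun y => Real.exp (l * L y)) π.toMeasure :=
    ProbabilityTheory.integrable_exp_mul_of_mem_Icc hm hb
  have hlint := MeasureTheory.ofReal_integral_eq_lintegral_ofReal hexp
    (Filter.Eventually.of_forall fun y => (Real.exp_pos _).le)
  rw [MeasureTheory.lintegral_countable'] at hlint
  have hsum : ∑' y, ENNReal.ofReal (p y * Real.exp (l * L y)) =
      ENNReal.ofReal (∫ y, Real.exp (l * L y) ∂π.toMeasure) := by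
    rw [hlint]
    refine tsum_congr fun y => ?_
    rw [PMF.toMeasure_apply_singleton _ _ (MeasurableSet.singleton y), hπ,
      ENNReal.ofReal_mul (hp0 y), mul_comm]
  rw [hsum]
  refine ENNReal.ofReal_le_ofReal ?_
  push_cast at hmgf
  rw [Real.norm_eq_abs, div_pow, sq_abs] at hmgf
  calc ∫ y, Real.exp (l * L y) ∂π.toMeasure
      = Real.exp (l * ∑' y, p y * L y) *
          ((∫ y, Real.exp (l * L y) ∂π.toMeasure) * Real.exp (-(l * ∑' y, p y * L y))) := by
        rw [mul_left_comm, ← Real.exp_add, add_neg_cancel, Real.exp_zero, mul_one]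
    _ ≤ Real.exp (l * ∑' y, p y * L y) * Real.exp ((b - a) ^ 2 / 2 ^ 2 * l ^ 2 / 2) := by
        gcongr
    _ = _ := by rw [← Real.exp_add]; congr 1; ring

variable {p q : α → ℝ} {e : ℝ}

lemma le_exp_mul_of_rangeBounded (hp1 : HasSum p 1) (hq1 : HasSum q 1)
    (h : ∀ y y', p y * q y' ≤ Real.exp e * (q y * p y')) (y : α) :
    p y ≤ Real.exp e * q y := by
  have := hasSum_le (h y) (hq1.mul_left (p y)) ((hp1.mul_left (q y)).mul_left (Real.exp e))
  simpa using this

lemma rangeBounded_swap (h : ∀ y y', p y * q y' ≤ Real.exp e * (q y * p y')) (y y' : α) :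
    q y * p y' ≤ Real.exp e * (p y * q y') := by
  have := h y' y
  linarith [mul_comm (p y') (q y), mul_comm (q y') (p y)]

lemma log_ratio_le_of_le_exp_mul (he : 0 ≤ e) (hp0 : ∀ y, 0 ≤ p y)
    {y : α} (h : p y ≤ Real.exp e * q y) : Real.log (p y / q y) ≤ e := by
  rcases (hp0 y).eq_or_lt with hp | hp
  · simpa [← hp] using he
  have hq : 0 < q y := pos_of_mul_pos_right (hp.trans_le h) (Real.exp_pos e).le
  rw [Real.log_le_iff_le_exp (div_pos hp hq), div_le_iff₀ hq]
  exact h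

lemma abs_log_ratio_le (he : 0 ≤ e) (hp0 : ∀ y, 0 ≤ p y) (hq0 : ∀ y, 0 ≤ q y)
    (hp1 : HasSum p 1) (hq1 : HasSum q 1)
    (h : ∀ y y', p y * q y' ≤ Real.exp e * (q y * p y')) (y : α) :
    |Real.log (p y / q y)| ≤ e := by
  refine abs_le.2 ⟨?_, log_ratio_le_of_le_exp_mul he hp0
    (le_exp_mul_of_rangeBounded hp1 hq1 h y)⟩
  have := log_ratio_le_of_le_exp_mul he hq0
    (le_exp_mul_of_rangeBounded hq1 hp1 (rangeBounded_swap h) y)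
  rw [← inv_div, Real.log_inv] at this
  linarith

lemma pos_iff_of_rangeBounded (hp1 : HasSum p 1) (hq1 : HasSum q 1)
    (h : ∀ y y', p y * q y' ≤ Real.exp e * (q y * p y')) (y : α) : 0 < p y ↔ 0 < q y :=
  ⟨fun hp => pos_of_mul_pos_right
      (hp.trans_le (le_exp_mul_of_rangeBounded hp1 hq1 h y)) (Real.exp_pos e).le,
    fun hq => pos_of_mul_pos_right
      (hq.trans_le (le_exp_mul_of_rangeBounded hq1 hp1 (rangeBounded_swap h) y))
      (Real.exp_pos e).le⟩

lemma log_ratio_sub_le (he : 0 ≤ e) (hp0 : ∀ y, 0 ≤ p y) (hq0 : ∀ y, 0 ≤ q y)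
    (hp1 : HasSum p 1) (hq1 : HasSum q 1)
    (h : ∀ y y', p y * q y' ≤ Real.exp e * (q y * p y')) (y y' : α) :
    Real.log (p y / q y) - Real.log (p y' / q y') ≤ e := by
  have hpq := pos_iff_of_rangeBounded hp1 hq1 h
  have habs := abs_log_ratio_le he hp0 hq0 hp1 hq1 h
  rcases (hp0 y).eq_or_lt with hp | hp
  · have := (abs_le.1 (habs y')).1
    simp only [← hp, zero_div, Real.log_zero]
    linarith
  rcases (hp0 y').eq_or_lt with hp' | hp'
  · have := (abs_le.1 (habs y)).2
    simp only [← hp', zero_div, Real.log_zero]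
    linarith
  have hq := (hpq y).1 hp
  have hq' := (hpq y').1 hp'
  rw [← Real.log_div (div_pos hp hq).ne' (div_pos hp' hq').ne',
    Real.log_le_iff_le_exp (div_pos (div_pos hp hq) (div_pos hp' hq')), div_div_div_eq,
    div_le_iff₀ (mul_pos hq hp')]
  exact h y y'

lemma exists_log_ratio_mem_Icc (he : 0 ≤ e) (hp0 : ∀ y, 0 ≤ p y) (hq0 : ∀ y, 0 ≤ q y)
    (hp1 : HasSum p 1) (hq1 : HasSum q 1)
    (h : ∀ y y', p y * q y' ≤ Real.exp e * (q y * p y')) :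
    ∃ a : ℝ, ∀ y, Real.log (p y / q y) ∈ Set.Icc a (a + e) := by
  have hne : Nonempty α := by
    by_contra hα
    rw [not_nonempty_iff] at hα
    exact zero_ne_one (hasSum_empty.unique hp1)
  have hbdd : BddBelow (Set.range fun y => Real.log (p y / q y)) := by
    refine ⟨-e, ?_⟩
    rintro _ ⟨y, rfl⟩
    exact (abs_le.1 (abs_log_ratio_le he hp0 hq0 hp1 hq1 h y)).1
  refine ⟨⨅ y, Real.log (p y / q y), fun y => ⟨ciInf_le hbdd y, ?_⟩⟩
  have : Real.log (p y / q y) - e ≤ ⨅ y, Real.log (p y / q y) :=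
    le_ciInf fun y' => by linarith [log_ratio_sub_le he hp0 hq0 hp1 hq1 h y y']
  linarith

/-- The Kullback-Leibler divergence of an `e`-range-bounded pair is at most `e ^ 2 / 8`. -/
lemma tsum_mul_log_ratio_le_sq [Countable α] (he : 0 ≤ e) (hp0 : ∀ y, 0 ≤ p y)
    (hq0 : ∀ y, 0 ≤ q y) (hp1 : HasSum p 1) (hq1 : HasSum q 1)
    (h : ∀ y y', p y * q y' ≤ Real.exp e * (q y * p y')) :
    ∑' y, p y * Real.log (p y / q y) ≤ e ^ 2 / 8 := by
  obtain ⟨a, ha⟩ := exists_log_ratio_mem_Icc he hp0 hq0 hp1 hq1 h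
  have hmgf := tsum_mul_exp_le_of_mem_Icc hp0 hp1 ha (-1)
  have hpq := pos_iff_of_rangeBounded hp1 hq1 h
  have hterm (y : α) : p y * Real.exp (-1 * Real.log (p y / q y)) = q y := by
    rcases (hp0 y).eq_or_lt with hp | hp
    · have : ¬ 0 < q y := by rw [← hpq y, ← hp]; exact lt_irrefl 0
      rw [← hp, zero_mul, le_antisymm (not_lt.1 this) (hq0 y)]
    · have hq := (hpq y).1 hp
      rw [neg_one_mul, Real.exp_neg, Real.exp_log (div_pos hp hq)]
      field_simp
  simp only [hterm] at hmgf
  rw [← ENNReal.ofReal_tsum_of_nonneg hq0 hq1.summable, hq1.tsum_eq,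
    ENNReal.ofReal_le_ofReal_iff (Real.exp_pos _).le, Real.one_le_exp_iff] at hmgf
  rw [add_sub_cancel_left] at hmgf
  linarith

lemma abs_sub_le_of_le_exp_mul {y : α}
    (hpq : p y ≤ Real.exp e * q y) (hqp : q y ≤ Real.exp e * p y) :
    |p y - q y| ≤ (Real.exp e - 1) / (Real.exp e + 1) * (p y + q y) := by
  have he := Real.exp_pos e
  rw [div_mul_eq_mul_div, le_div_iff₀ (by positivity)]
  rcases abs_cases (p y - q y) with ⟨h, _⟩ | ⟨h, _⟩ <;> rw [h] <;> nlinarith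

/-- The Kullback-Leibler divergence of an `e`-range-bounded pair is at most `e * tanh (e / 2)`. -/
lemma tsum_mul_log_ratio_le_tanh (he : 0 ≤ e) (hp0 : ∀ y, 0 ≤ p y)
    (hq0 : ∀ y, 0 ≤ q y) (hp1 : HasSum p 1) (hq1 : HasSum q 1)
    (h : ∀ y y', p y * q y' ≤ Real.exp e * (q y * p y')) :
    ∑' y, p y * Real.log (p y / q y) ≤ e * ((Real.exp e - 1) / (Real.exp e + 1)) := by
  obtain ⟨a, ha⟩ := exists_log_ratio_mem_Icc he hp0 hq0 hp1 hq1 h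
  have hpq := pos_iff_of_rangeBounded hp1 hq1 h
  set τ := (Real.exp e - 1) / (Real.exp e + 1)
  have hbound (y : α) : p y * Real.log (p y / q y) ≤
      e / 2 * τ * (p y + q y) + (a + e / 2 + 1) * (p y - q y) := by
    have habs := abs_sub_le_of_le_exp_mul
      (le_exp_mul_of_rangeBounded hp1 hq1 h y)
      (le_exp_mul_of_rangeBounded hq1 hp1 (rangeBounded_swap h) y)
    have hcenter : |Real.log (p y / q y) - (a + e / 2)| ≤ e / 2 := by
      obtain ⟨h₁, h₂⟩ := ha y
      exact abs_le.2 ⟨by linarith, by linarith⟩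
    have hprod : (p y - q y) * (Real.log (p y / q y) - (a + e / 2)) ≤
        τ * (p y + q y) * (e / 2) := by
      refine (le_abs_self _).trans ?_
      rw [abs_mul]
      exact mul_le_mul habs hcenter (abs_nonneg _) ((abs_nonneg _).trans habs)
    have hlog : q y * Real.log (p y / q y) ≤ p y - q y := by
      rcases (hq0 y).eq_or_lt with hq | hq
      · simpa [← hq] using hp0 y
      · have := Real.log_le_sub_one_of_pos (div_pos ((hpq y).2 hq) hq)
        calc q y * Real.log (p y / q y) ≤ q y * (p y / q y - 1) := by gcongr
          _ = p y - q y := by field_simp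
    linarith
  have hsum : Summable fun y => p y * Real.log (p y / q y) := by
    refine Summable.of_norm_bounded (hp1.summable.mul_right e) fun y => ?_
    rw [norm_mul, Real.norm_of_nonneg (hp0 y)]
    exact mul_le_mul_of_nonneg_left (abs_log_ratio_le he hp0 hq0 hp1 hq1 h y) (hp0 y)
  have := hasSum_le hbound hsum.hasSum
    (((hp1.add hq1).mul_left (e / 2 * τ)).add ((hp1.sub hq1).mul_left (a + e / 2 + 1)))
  linarith

/-- The moment generating function of the privacy loss of a range-bounded pair. -/
lemma tsum_mul_exp_log_ratio_le [Countable α] (he : 0 ≤ e) (hp0 : ∀ y, 0 ≤ p y)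
    (hq0 : ∀ y, 0 ≤ q y) (hp1 : HasSum p 1) (hq1 : HasSum q 1)
    (h : ∀ y y', p y * q y' ≤ Real.exp e * (q y * p y')) {l m : ℝ} (hl : 0 ≤ l)
    (hm : ∑' y, p y * Real.log (p y / q y) ≤ m) :
    ∑' y, ENNReal.ofReal (p y * Real.exp (l * Real.log (p y / q y))) ≤
      ENNReal.ofReal (Real.exp (l * m + l ^ 2 * e ^ 2 / 8)) := by
  obtain ⟨a, ha⟩ := exists_log_ratio_mem_Icc he hp0 hq0 hp1 hq1 h
  refine (tsum_mul_exp_le_of_mem_Icc hp0 hp1 ha l).trans ?_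
  rw [add_sub_cancel_left]
  gcongr

end SingleStep

section Composition

/-- If every kernel of a sequential product has total mass at most `c i`, then the product has
total mass at most `∏ i, c i`. -/
lemma tsum_prod_kernel_le {t : ℕ} {Y : Fin t → Type*}
    (F : ∀ i : Fin t, (∀ j : Fin (i : ℕ), Y ⟨(j : ℕ), j.2.trans i.2⟩) → Y i → ENNReal)
    (c : Fin t → ENNReal) (hF : ∀ i v, ∑' y, F i v y ≤ c i) :
    ∑' y : ∀ i, Y i, ∏ i, F i (fun j => y ⟨(j : ℕ), j.2.trans i.2⟩) (y i) ≤ ∏ i, c i := by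
  induction t with
  | zero => simp
  | succ t ih =>
    let G : Y (Fin.last t) × (∀ i : Fin t, Y i.castSucc) → ENNReal := fun z =>
      (∏ i : Fin t, F i.castSucc (fun j => z.2 ⟨(j : ℕ), j.2.trans i.2⟩) (z.2 i)) *
        F (Fin.last t) (fun j => z.2 j) z.1
    have hG : ∑' y : ∀ i, Y i, ∏ i, F i (fun j => y ⟨(j : ℕ), j.2.trans i.2⟩) (y i) =
        ∑' y : ∀ i, Y i, G ((Fin.snocEquiv Y).symm y) := by
      refine tsum_congr fun y => ?_
      rw [Fin.prod_univ_castSucc]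
      rfl
    rw [hG, (Fin.snocEquiv Y).symm.tsum_eq G, ENNReal.tsum_prod', ENNReal.tsum_comm,
      Fin.prod_univ_castSucc]
    simp only [G, ENNReal.tsum_mul_left]
    have hlast (v : ∀ i : Fin t, Y i.castSucc) :
        ∑' x, F (Fin.last t) (fun j => v j) x ≤ c (Fin.last t) := hF _ _
    refine (ENNReal.tsum_le_tsum fun v => mul_le_mul_right (hlast v) _).trans ?_
    rw [ENNReal.tsum_mul_right]
    gcongr
    exact ih (Y := fun i => Y i.castSucc) (fun i => F i.castSucc) (fun i => c i.castSucc)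
      fun i v => hF i.castSucc v

lemma summable_and_tsum_le_of_tsum_ofReal_le {α : Type*} {f : α → ℝ} {c : ℝ}
    (hf : ∀ y, 0 ≤ f y) (hc : 0 ≤ c) (h : ∑' y, ENNReal.ofReal (f y) ≤ ENNReal.ofReal c) :
    Summable f ∧ ∑' y, f y ≤ c := by
  have hs : Summable f := by
    have := ENNReal.summable_toReal (h.trans_lt ENNReal.ofReal_lt_top).ne
    simpa only [ENNReal.toReal_ofReal (hf _)] using this
  rw [← ENNReal.ofReal_tsum_of_nonneg hf hs, ENNReal.ofReal_le_ofReal_iff hc] at h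
  exact ⟨hs, h⟩

lemma summable_and_tsum_prod_kernel_le {t : ℕ} {Y : Fin t → Type*}
    {F : ∀ i : Fin t, (∀ j : Fin (i : ℕ), Y ⟨(j : ℕ), j.2.trans i.2⟩) → Y i → ℝ}
    {c : Fin t → ℝ} (hF0 : ∀ i v y, 0 ≤ F i v y) (hc : ∀ i, 0 ≤ c i)
    (hF : ∀ i v, ∑' y, ENNReal.ofReal (F i v y) ≤ ENNReal.ofReal (c i)) :
    Summable (fun y : ∀ i, Y i => ∏ i, F i (fun j => y ⟨(j : ℕ), j.2.trans i.2⟩) (y i)) ∧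
      ∑' y : ∀ i, Y i, ∏ i, F i (fun j => y ⟨(j : ℕ), j.2.trans i.2⟩) (y i) ≤ ∏ i, c i := by
  refine summable_and_tsum_le_of_tsum_ofReal_le (fun y => Finset.prod_nonneg fun i _ => hF0 _ _ _)
    (Finset.prod_nonneg fun i _ => hc i) ?_
  simp only [ENNReal.ofReal_prod_of_nonneg fun i _ => hF0 i _ _,
    ENNReal.ofReal_prod_of_nonneg fun i _ => hc i]
  exact tsum_prod_kernel_le (fun i v y => ENNReal.ofReal (F i v y)) _ hF

lemma summable_prod_kernel {t : ℕ} {Y : Fin t → Type*}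
    {F : ∀ i : Fin t, (∀ j : Fin (i : ℕ), Y ⟨(j : ℕ), j.2.trans i.2⟩) → Y i → ℝ}
    (hF0 : ∀ i v y, 0 ≤ F i v y) (hF1 : ∀ i v, HasSum (F i v) 1) :
    Summable (fun y : ∀ i, Y i => ∏ i, F i (fun j => y ⟨(j : ℕ), j.2.trans i.2⟩) (y i)) :=
  (summable_and_tsum_prod_kernel_le (c := fun _ => 1) hF0 (fun _ => zero_le_one) fun i v => by
    rw [← ENNReal.ofReal_tsum_of_nonneg (hF0 i v) (hF1 i v).summable, (hF1 i v).tsum_eq]).1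

/-- Chernoff's method, pointwise: split according to whether the total log-ratio exceeds `E`. -/
lemma prod_le_exp_mul_prod_add {ι : Type*} [Fintype ι] {p q : ι → ℝ} (hp0 : ∀ i, 0 ≤ p i)
    (hq0 : ∀ i, 0 ≤ q i) (hpq : ∀ i, 0 < p i → 0 < q i) {l : ℝ} (hl : 0 ≤ l) (E : ℝ) :
    ∏ i, p i ≤ Real.exp E * ∏ i, q i +
      Real.exp (-(l * E)) * ∏ i, p i * Real.exp (l * Real.log (p i / q i)) := by
  have hQ : 0 ≤ ∏ i, q i := Finset.prod_nonneg fun i _ => hq0 i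
  have hP : 0 ≤ ∏ i, p i := Finset.prod_nonneg fun i _ => hp0 i
  rw [Finset.prod_mul_distrib, ← Real.exp_sum, ← Finset.mul_sum, mul_left_comm, ← Real.exp_add]
  set Λ := ∑ i, Real.log (p i / q i) with hΛ
  by_cases hpos : ∀ i, 0 < p i
  · rcases le_total Λ E with hE | hE
    · have hprod : ∏ i, p i = Real.exp Λ * ∏ i, q i := by
        rw [hΛ, Real.exp_sum, ← Finset.prod_mul_distrib]
        refine Finset.prod_congr rfl fun i _ => ?_
        have hq := hpq i (hpos i)
        rw [Real.exp_log (div_pos (hpos i) hq), div_mul_cancel₀ _ hq.ne']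
      have : ∏ i, p i ≤ Real.exp E * ∏ i, q i := by
        rw [hprod]
        gcongr
      exact this.trans (le_add_of_nonneg_right (by positivity))
    · have : 1 ≤ Real.exp (-(l * E) + l * Λ) := by
        rw [Real.one_le_exp_iff]
        nlinarith [mul_le_mul_of_nonneg_left hE hl]
      exact (le_mul_of_one_le_right hP this).trans (le_add_of_nonneg_left (by positivity))
  · push Not at hpos
    obtain ⟨i, hi⟩ := hpos
    rw [Finset.prod_eq_zero (Finset.mem_univ i) (le_antisymm hi (hp0 i)), zero_mul, add_zero]
    positivity

variable {t : ℕ} {Y : Fin t → Type*} {ε : Fin t → ℝ}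
  {P Q : ∀ i : Fin t, (∀ j : Fin (i : ℕ), Y ⟨(j : ℕ), j.2.trans i.2⟩) → Y i → ℝ}

/-- Basic composition. -/
lemma tsum_prod_kernel_le_exp_sum_mul
    (hP0 : ∀ i v y, 0 ≤ P i v y) (hQ0 : ∀ i v y, 0 ≤ Q i v y)
    (hP1 : ∀ i v, HasSum (P i v) 1) (hQ1 : ∀ i v, HasSum (Q i v) 1)
    (hrb : ∀ i v (y y' : Y i), P i v y * Q i v y' ≤ Real.exp (ε i) * (Q i v y * P i v y'))
    (S : Set (∀ i, Y i)) :
    ∑' y : S, ∏ i, P i (fun j => (y : ∀ i, Y i) ⟨(j : ℕ), j.2.trans i.2⟩) ((y : ∀ i, Y i) i) ≤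
      Real.exp (∑ i, ε i) *
        ∑' y : S, ∏ i, Q i (fun j => (y : ∀ i, Y i) ⟨(j : ℕ), j.2.trans i.2⟩)
          ((y : ∀ i, Y i) i) := by
  rw [← tsum_mul_left]
  refine Summable.tsum_le_tsum (fun y => ?_) ((summable_prod_kernel hP0 hP1).subtype S)
    (((summable_prod_kernel hQ0 hQ1).subtype S).mul_left _)
  rw [Real.exp_sum, ← Finset.prod_mul_distrib]
  exact Finset.prod_le_prod (fun i _ => hP0 _ _ _) fun i _ =>
    le_exp_mul_of_rangeBounded (hP1 i _) (hQ1 i _) (hrb i _) _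

/-- Advanced composition, in terms of bounds `m i` on the Kullback-Leibler divergences of the
steps. -/
lemma tsum_prod_kernel_le_exp_mul_add [∀ i, Countable (Y i)] (hε : ∀ i, 0 ≤ ε i)
    (hV : 0 < ∑ i, ε i ^ 2)
    (hP0 : ∀ i v y, 0 ≤ P i v y) (hQ0 : ∀ i v y, 0 ≤ Q i v y)
    (hP1 : ∀ i v, HasSum (P i v) 1) (hQ1 : ∀ i v, HasSum (Q i v) 1)
    (hrb : ∀ i v (y y' : Y i), P i v y * Q i v y' ≤ Real.exp (ε i) * (Q i v y * P i v y'))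
    {m : Fin t → ℝ} (hm : ∀ i v, ∑' y, P i v y * Real.log (P i v y / Q i v y) ≤ m i)
    {δ : ℝ} (hδ : δ ∈ Set.Ioo (0 : ℝ) 1) {E : ℝ}
    (hE : ∑ i, m i + Real.sqrt ((1 / 2) * (∑ i, ε i ^ 2) * Real.log (1 / δ)) ≤ E)
    (S : Set (∀ i, Y i)) :
    ∑' y : S, ∏ i, P i (fun j => (y : ∀ i, Y i) ⟨(j : ℕ), j.2.trans i.2⟩) ((y : ∀ i, Y i) i) ≤
      Real.exp E *
        (∑' y : S, ∏ i, Q i (fun j => (y : ∀ i, Y i) ⟨(j : ℕ), j.2.trans i.2⟩)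
          ((y : ∀ i, Y i) i)) + δ := by
  set V := ∑ i, ε i ^ 2
  set s := Real.sqrt ((1 / 2) * V * Real.log (1 / δ))
  have hlog : Real.log (1 / δ) = -Real.log δ := by rw [one_div, Real.log_inv]
  have hs : s ^ 2 = (1 / 2) * V * -Real.log δ := by
    have := Real.log_neg hδ.1 hδ.2
    rw [Real.sq_sqrt (mul_nonneg (by positivity) (by linarith)), hlog]
  set l := 4 * s / V with hl_def
  have hl : 0 ≤ l := div_nonneg (mul_nonneg (by norm_num) (Real.sqrt_nonneg _)) hV.le
  obtain ⟨hWs, hW⟩ := summable_and_tsum_prod_kernel_le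
    (F := fun i v y => P i v y * Real.exp (l * Real.log (P i v y / Q i v y)))
    (c := fun i => Real.exp (l * m i + l ^ 2 * ε i ^ 2 / 8))
    (fun i v y => mul_nonneg (hP0 i v y) (Real.exp_pos _).le) (fun i => (Real.exp_pos _).le)
    (fun i v => tsum_mul_exp_log_ratio_le (hε i) (hP0 i v) (hQ0 i v) (hP1 i v) (hQ1 i v)
      (hrb i v) hl (hm i v))
  have hQs := (summable_prod_kernel hQ0 hQ1).subtype S
  have htail : Real.exp (-(l * E)) *
      ∏ i, Real.exp (l * m i + l ^ 2 * ε i ^ 2 / 8) ≤ δ := by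
    rw [← Real.exp_sum, ← Real.exp_add, ← Real.le_log_iff_exp_le hδ.1, Finset.sum_add_distrib,
      ← Finset.mul_sum, ← Finset.sum_div, ← Finset.mul_sum]
    change -(l * E) + (l * ∑ i, m i + l ^ 2 * V / 8) ≤ Real.log δ
    have h₁ : l * (∑ i, m i + s) ≤ l * E := mul_le_mul_of_nonneg_left hE hl
    have h₂ : l ^ 2 * V / 8 - l * s = Real.log δ := by
      have : l ^ 2 * V / 8 - l * s = -2 * s ^ 2 / V := by
        rw [hl_def]
        field_simp
        ring
      rw [this, hs]
      field_simp
    linarith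
  calc _ ≤ ∑' y : S, (Real.exp E *
            (∏ i, Q i (fun j => (y : ∀ i, Y i) ⟨(j : ℕ), j.2.trans i.2⟩) ((y : ∀ i, Y i) i)) +
          Real.exp (-(l * E)) *
            ∏ i, (P i (fun j => (y : ∀ i, Y i) ⟨(j : ℕ), j.2.trans i.2⟩) ((y : ∀ i, Y i) i) *
              Real.exp (l * Real.log
                (P i (fun j => (y : ∀ i, Y i) ⟨(j : ℕ), j.2.trans i.2⟩) ((y : ∀ i, Y i) i) /
                  Q i (fun j => (y : ∀ i, Y i) ⟨(j : ℕ), j.2.trans i.2⟩)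
                    ((y : ∀ i, Y i) i))))) := by
        refine Summable.tsum_le_tsum (fun y => ?_) ((summable_prod_kernel hP0 hP1).subtype S)
          ((hQs.mul_left _).add ((hWs.subtype S).mul_left _))
        exact prod_le_exp_mul_prod_add (fun i => hP0 _ _ _) (fun i => hQ0 _ _ _)
          (fun i => (pos_iff_of_rangeBounded (hP1 i _) (hQ1 i _) (hrb i _) _).1) hl E
    _ ≤ _ := by
        refine ((hQs.mul_left _).tsum_add ((hWs.subtype S).mul_left _)).trans_le ?_
        rw [tsum_mul_left, tsum_mul_left]
        refine add_le_add le_rfl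
          ((mul_le_mul_of_nonneg_left ?_ (Real.exp_pos _).le).trans htail)
        refine (hWs.tsum_subtype_le _ S fun y => ?_).trans hW
        exact Finset.prod_nonneg fun i _ => mul_nonneg (hP0 _ _ _) (Real.exp_pos _).le

end Composition

/-- Lemma 6 (improved advanced composition for range-bounded mechanisms): the adaptive
composition of `εᵢ`-range-bounded mechanisms `P` vs `Q` (the output distributions of the
`i`-th mechanism on the two fixed neighboring inputs, given the history) satisfies
`(ε'', δ)`-DP with
`ε'' = min{∑ εᵢ, ∑ εᵢ(e^{εᵢ}−1)/(e^{εᵢ}+1) + √(2 ∑ εᵢ² ln(1/δ)), ∑ εᵢ²/2 + √((1/2) ∑ εᵢ² ln(1/δ))}`. -/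
theorem stmt_4 (t : ℕ) (ht : 1 ≤ t) (Y : Fin t → Type*) [∀ i, Countable (Y i)]
    (ε : Fin t → ℝ) (hε : ∀ i, 0 < ε i)
    (P Q : ∀ i : Fin t, (∀ j : Fin (i : ℕ), Y ⟨(j : ℕ), j.2.trans i.2⟩) → Y i → ℝ)
    (hP0 : ∀ i v y, 0 ≤ P i v y) (hQ0 : ∀ i v y, 0 ≤ Q i v y)
    (hP1 : ∀ i v, HasSum (P i v) 1) (hQ1 : ∀ i v, HasSum (Q i v) 1)
    (hrb : ∀ i v (y y' : Y i),
      P i v y * Q i v y' ≤ Real.exp (ε i) * (Q i v y * P i v y'))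
    (δ : ℝ) (hδ : δ ∈ Set.Ioo (0 : ℝ) 1)
    (S : Set (∀ i, Y i)) :
    ∑' y : S, ∏ i, P i (fun j => (y : ∀ i, Y i) ⟨(j : ℕ), j.2.trans i.2⟩) ((y : ∀ i, Y i) i) ≤
      Real.exp (min (∑ i, ε i)
        (min (∑ i, ε i * ((Real.exp (ε i) - 1) / (Real.exp (ε i) + 1)) +
                Real.sqrt (2 * (∑ i, ε i ^ 2) * Real.log (1 / δ)))
             (∑ i, ε i ^ 2 / 2 +
                Real.sqrt ((1 / 2) * (∑ i, ε i ^ 2) * Real.log (1 / δ))))) *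
        (∑' y : S, ∏ i, Q i (fun j => (y : ∀ i, Y i) ⟨(j : ℕ), j.2.trans i.2⟩)
            ((y : ∀ i, Y i) i)) + δ := by
  have hV : 0 < ∑ i, ε i ^ 2 :=
    Finset.sum_pos (fun i _ => pow_pos (hε i) 2) ⟨⟨0, ht⟩, Finset.mem_univ _⟩
  have hε' := fun i => (hε i).le
  have hlog : 0 ≤ Real.log (1 / δ) := Real.log_nonneg (by rw [le_div_iff₀ hδ.1]; linarith [hδ.2])
  rcases min_choice (∑ i, ε i) _ with h | h <;> rw [h]
  · exact (tsum_prod_kernel_le_exp_sum_mul hP0 hQ0 hP1 hQ1 hrb S).trans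
      (le_add_of_nonneg_right hδ.1.le)
  clear h
  rcases min_choice (∑ i, ε i * ((Real.exp (ε i) - 1) / (Real.exp (ε i) + 1)) +
    Real.sqrt (2 * (∑ i, ε i ^ 2) * Real.log (1 / δ))) _ with h | h <;> rw [h]
  · refine tsum_prod_kernel_le_exp_mul_add hε' hV hP0 hQ0 hP1 hQ1 hrb
      (fun i v => tsum_mul_log_ratio_le_tanh (hε' i) (hP0 i v) (hQ0 i v) (hP1 i v) (hQ1 i v)
        (hrb i v)) hδ ?_ S
    gcongr
    norm_num
  · refine tsum_prod_kernel_le_exp_mul_add hε' hV hP0 hQ0 hP1 hQ1 hrb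
      (fun i v => (tsum_mul_log_ratio_le_sq (hε' i) (hP0 i v) (hQ0 i v) (hP1 i v) (hQ1 i v)
        (hrb i v)).trans ?_) hδ le_rfl S
    linarith [sq_nonneg (ε i)]
end

section
/- Let d ≥ 1 and let h, h' : Fin d → ℕ satisfy h'(i) ≤ h(i) ≤ h'(i) + 1 for all i. Then for every 1 ≤ k̄ ≤ d, either h_{(k̄)} = h'_{(k̄)} or h_{(k̄)} = h'_{(k̄)} + 1, where h_{(k̄)} denotes the k̄-th largest value among the entries of h (and h'_{(k̄)} that of h'). -/
/-- The `k`-th largest value among the entries of the histogram `h`: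
the largest value `v` such that at least `k` entries of `h` are `≥ v`. -/
noncomputable def kthLargest {d : ℕ} (h : Fin d → ℕ) (k : ℕ) : ℕ :=
  sSup {v | k ≤ (Finset.univ.filter fun i => v ≤ h i).card}

theorem bddAbove_card_filter_le {d k : ℕ} (h : Fin d → ℕ) (hk : 1 ≤ k) :
    BddAbove {v | k ≤ (Finset.univ.filter fun i => v ≤ h i).card} := by
  refine ⟨Finset.univ.sup h, fun v hv => ?_⟩
  obtain ⟨i, hi⟩ := Finset.card_pos.mp (hk.trans hv)
  exact (Finset.mem_filter.mp hi).2.trans (Finset.le_sup (Finset.mem_univ i))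

theorem le_kthLargest {d k v : ℕ} {h : Fin d → ℕ} (hk : 1 ≤ k)
    (hv : k ≤ (Finset.univ.filter fun i => v ≤ h i).card) : v ≤ kthLargest h k :=
  le_csSup (bddAbove_card_filter_le h hk) hv

theorem le_card_filter_kthLargest_le {d k : ℕ} (h : Fin d → ℕ) (hk : 1 ≤ k) (hkd : k ≤ d) :
    k ≤ (Finset.univ.filter fun i => kthLargest h k ≤ h i).card :=
  Nat.sSup_mem (s := {v | k ≤ (Finset.univ.filter fun i => v ≤ h i).card})
    ⟨0, by simpa using hkd⟩ (bddAbove_card_filter_le h hk)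

theorem kthLargest_le_add {d k c : ℕ} {f g : Fin d → ℕ} (hk : 1 ≤ k) (hkd : k ≤ d)
    (hfg : ∀ i, f i ≤ g i + c) : kthLargest f k ≤ kthLargest g k + c := by
  refine Nat.sub_le_iff_le_add.mp (le_kthLargest hk ?_)
  refine (le_card_filter_kthLargest_le f hk hkd).trans (Finset.card_le_card fun i hi => ?_)
  simp only [Finset.mem_filter, Finset.mem_univ, true_and] at hi ⊢
  exact Nat.sub_le_iff_le_add.mpr (hi.trans (hfg i))

/-- Lemma 7 (thresholds are similar): on neighboring histograms with `h' ≤ h ≤ h' + 1`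
coordinatewise, the `k̄`-th largest value changes by at most one. -/
theorem stmt_5 (d : ℕ) (hd : 1 ≤ d) (h h' : Fin d → ℕ)
    (hnb : ∀ i, h' i ≤ h i ∧ h i ≤ h' i + 1)
    (kbar : ℕ) (hk1 : 1 ≤ kbar) (hkd : kbar ≤ d) :
    kthLargest h kbar = kthLargest h' kbar ∨ kthLargest h kbar = kthLargest h' kbar + 1 := by
  have h_ge := kthLargest_le_add (c := 0) hk1 hkd fun i => (hnb i).1
  have h_le := kthLargest_le_add hk1 hkd fun i => (hnb i).2
  omega
end

section
/- Let h, h' : Fin d → ℕ be neighboring histograms and fix k̄ < d. If i ∈ D_{k̄}(h) \ D_{k̄}(h'), then h(i) ≤ h_{(k̄+1)} + 1; and if i ∈ D_{k̄}(h') \ D_{k̄}(h), then h'(i) ≤ h'_{(k̄+1)} + 1. -/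
/-- Histograms are neighboring if one user's data is added or removed: one dominates
the other, coordinatewise, by at most one. -/
def Neighbors {d : ℕ} (h h' : Fin d → ℕ) : Prop :=
  (∀ i, h' i ≤ h i ∧ h i ≤ h' i + 1) ∨ (∀ i, h i ≤ h' i ∧ h' i ≤ h i + 1)

/-- The rank (number of strictly preceding indices) of index `i` in the ordering of `h`
by decreasing count, with ties broken toward smaller indices. -/
def histRank {d : ℕ} (h : Fin d → ℕ) (i : Fin d) : ℕ :=
  (Finset.univ.filter fun j => h i < h j ∨ (h j = h i ∧ j < i)).card

/-- The limited domain `D_k(h)`: the indices of the `k` largest entries of `h`,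
ties broken by a fixed data-independent rule (smaller index first). -/
def limitedDomain {d : ℕ} (h : Fin d → ℕ) (k : ℕ) : Finset (Fin d) :=
  Finset.univ.filter fun i => histRank h i < k

theorem Neighbors.symm {d : ℕ} {h h' : Fin d → ℕ} (hnb : Neighbors h h') : Neighbors h' h :=
  Or.symm hnb

/-- A value attained or exceeded by at least `k + 1` entries is at most the `(k+1)`-th largest. -/
theorem le_kthLargest_succ {d : ℕ} {h : Fin d → ℕ} {k v : ℕ}
    (hv : k + 1 ≤ (Finset.univ.filter fun i => v ≤ h i).card) : v ≤ kthLargest h (k + 1) := by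
  refine le_csSup ⟨Finset.univ.sup h, fun w hw => ?_⟩ hv
  obtain ⟨j, hj⟩ := Finset.card_pos.mp (lt_of_lt_of_le k.succ_pos hw)
  exact (Finset.mem_filter.mp hj).2.trans (Finset.le_sup (Finset.mem_univ j))

/-- The indices with count at least `h i` include `i` and all indices preceding it. -/
theorem histRank_succ_le_card {d : ℕ} (h : Fin d → ℕ) (i : Fin d) :
    histRank h i + 1 ≤ (Finset.univ.filter fun j => h i ≤ h j).card := by
  refine Finset.card_lt_card (Finset.ssubset_iff_of_subset ?_ |>.mpr ⟨i, by simp, by simp⟩)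
  intro j hj
  simp only [Finset.mem_filter, Finset.mem_univ, true_and] at hj ⊢
  omega

theorem Neighbors.le_kthLargest_succ_add_one {d : ℕ} {h h' : Fin d → ℕ} (hnb : Neighbors h h')
    {k : ℕ} {i : Fin d} (hi : i ∉ limitedDomain h' k) : h i ≤ kthLargest h (k + 1) + 1 := by
  have hrank : k ≤ histRank h' i := by simpa [limitedDomain] using hi
  refine Nat.sub_le_iff_le_add.mp (le_kthLargest_succ ?_)
  refine (Nat.succ_le_succ hrank).trans ((histRank_succ_le_card h' i).trans ?_)
  refine Finset.card_le_card fun j hj => ?_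
  simp only [Finset.mem_filter, Finset.mem_univ, true_and] at hj ⊢
  rcases hnb with hnb | hnb <;> have hi := hnb i <;> have hj := hnb j <;> omega

/-- Lemma 8: for neighboring histograms, an index in the limited domain of one but not the
other has count at most one above the `(k̄+1)`-th largest count. -/
theorem stmt_6 (d : ℕ) (h h' : Fin d → ℕ) (hnb : Neighbors h h') (kbar : ℕ) (hkd : kbar < d) :
    (∀ i ∈ limitedDomain h kbar \ limitedDomain h' kbar, h i ≤ kthLargest h (kbar + 1) + 1) ∧
    (∀ i ∈ limitedDomain h' kbar \ limitedDomain h kbar, h' i ≤ kthLargest h' (kbar + 1) + 1) := by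
  exact ⟨fun i hi => hnb.le_kthLargest_succ_add_one (Finset.mem_sdiff.mp hi).2,
    fun i hi => hnb.symm.le_kthLargest_succ_add_one (Finset.mem_sdiff.mp hi).2⟩
end

section
/- Let h, h' : Fin d → ℕ be Δ-restricted-sensitivity neighboring histograms and fix k̄ < d. Then |D_{k̄}(h) \ D_{k̄}(h')| ≤ min{Δ, k̄, d − k̄}. -/
/-- `Δ`-restricted-sensitivity neighbors: neighboring histograms which moreover differ in
at most `Δ` coordinates. -/
def RestrictedNeighbors {d : ℕ} (Δ : ℕ) (h h' : Fin d → ℕ) : Prop :=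
  Neighbors h h' ∧ (Finset.univ.filter fun i => h i ≠ h' i).card ≤ Δ

theorem histRank_lt_histRank {d : ℕ} (h : Fin d → ℕ) {i j : Fin d}
    (hij : h j < h i ∨ (h i = h j ∧ i < j)) : histRank h i < histRank h j := by
  refine Finset.card_lt_card (Finset.ssubset_iff_of_subset ?_ |>.2 ⟨i, ?_, ?_⟩)
  · intro l hl
    simp only [Finset.mem_filter, Finset.mem_univ, true_and] at hl ⊢
    omega
  · simpa using hij
  · simp

theorem histRank_injective {d : ℕ} (h : Fin d → ℕ) : Function.Injective (histRank h) := by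
  intro i j hij
  by_contra hne
  have key : (h j < h i ∨ (h i = h j ∧ i < j)) ∨ (h i < h j ∨ (h j = h i ∧ j < i)) := by
    omega
  rcases key with hlt | hlt
  · exact (histRank_lt_histRank h hlt).ne hij
  · exact (histRank_lt_histRank h hlt).ne' hij

theorem histRank_lt {d : ℕ} (h : Fin d → ℕ) (i : Fin d) : histRank h i < d := by
  have hlt : histRank h i < (Finset.univ : Finset (Fin d)).card :=
    Finset.card_lt_card (Finset.filter_ssubset.2 ⟨i, by simp⟩)
  simpa using hlt

theorem image_histRank {d : ℕ} (h : Fin d → ℕ) :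
    Finset.univ.image (histRank h) = Finset.range d := by
  refine Finset.eq_of_subset_of_card_le ?_ ?_
  · intro r hr
    obtain ⟨i, -, rfl⟩ := Finset.mem_image.1 hr
    exact Finset.mem_range.2 (histRank_lt h i)
  · simp [Finset.card_image_of_injective _ (histRank_injective h)]

theorem card_limitedDomain {d : ℕ} (h : Fin d → ℕ) {k : ℕ} (hk : k ≤ d) :
    (limitedDomain h k).card = k := by
  rw [← Finset.card_image_of_injective _ (histRank_injective h)]
  have himage : (limitedDomain h k).image (histRank h) = Finset.range k := by
    rw [limitedDomain, ← Finset.filter_image (p := fun r => r < k), image_histRank]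
    ext r
    simp only [Finset.mem_filter, Finset.mem_range]
    omega
  rw [himage, Finset.card_range]

/-- Lowering some entries of a histogram can only expel changed indices from its limited domain. -/
theorem limitedDomain_sdiff_subset {d : ℕ} {h h' : Fin d → ℕ} (hle : ∀ i, h' i ≤ h i) (k : ℕ) :
    limitedDomain h k \ limitedDomain h' k ⊆ Finset.univ.filter fun i => h i ≠ h' i := by
  intro i hi
  simp only [limitedDomain, Finset.mem_sdiff, Finset.mem_filter, Finset.mem_univ, true_and]
    at hi ⊢
  intro heq
  refine hi.2 (lt_of_le_of_lt (Finset.card_le_card fun j hj => ?_) hi.1)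
  have := hle j
  simp only [Finset.mem_filter, Finset.mem_univ, true_and] at hj ⊢
  omega

/-- Lemma 9: the set difference of the limited domains of `Δ`-restricted-sensitivity
neighboring histograms has size at most `min {Δ, k̄, d − k̄}`. -/
theorem stmt_7 (d : ℕ) (Δ : ℕ) (h h' : Fin d → ℕ) (hnb : RestrictedNeighbors Δ h h')
    (kbar : ℕ) (hkd : kbar < d) :
    (limitedDomain h kbar \ limitedDomain h' kbar).card ≤ min Δ (min kbar (d - kbar)) := by
  have hcard := card_limitedDomain h hkd.le
  have hcard' := card_limitedDomain h' hkd.le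
  obtain ⟨hnb, hΔ⟩ := hnb
  refine le_min ?_ (le_min ?_ ?_)
  · rcases hnb with hle | hle
    · exact (Finset.card_le_card (limitedDomain_sdiff_subset (fun i => (hle i).1) kbar)).trans hΔ
    · rw [Finset.card_sdiff_comm (hcard.trans hcard'.symm)]
      refine (Finset.card_le_card
        (limitedDomain_sdiff_subset (fun i => (hle i).1) kbar)).trans ?_
      simpa only [ne_comm] using hΔ
  · exact (Finset.card_le_card Finset.sdiff_subset).trans hcard.le
  · calc (limitedDomain h kbar \ limitedDomain h' kbar).card
        ≤ (limitedDomain h' kbar)ᶜ.card := Finset.card_le_card fun i hi =>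
          Finset.mem_compl.2 (Finset.mem_sdiff.1 hi).2
      _ = d - kbar := by rw [Finset.card_compl, hcard', Fintype.card_fin]
end

section
/- Let ε > 0, Δ ≥ 1, and 0 < δ ≤ Δ, and set T = ln(Δ/δ)/ε. If X and Y are independent real random variables, each with the Laplace density p(z) = (ε/2)·e^{−ε|z|}, then Pr[ X > T + Y ] ≤ 3δ/(4Δ) + δ·ln(Δ/δ)/(4Δ). -/
open MeasureTheory

theorem lintegral_Ioi_const_mul_exp_neg (c k t : ℝ) (hc : 0 ≤ c) (hk : 0 < k) :
    ∫⁻ x in Set.Ioi t, ENNReal.ofReal (c * Real.exp (-(k * x))) =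
      ENNReal.ofReal (c / k * Real.exp (-(k * t))) := by
  have hneg : -k < 0 := by linarith
  have hint := (integrableOn_exp_mul_Ioi hneg t).const_mul c
  simp only [neg_mul] at hint
  rw [← ofReal_integral_eq_lintegral_ofReal hint (ae_of_all _ fun x => by positivity),
    integral_const_mul]
  have h := integral_exp_mul_Ioi hneg t
  simp only [neg_mul] at h
  rw [h]
  congr 1
  field_simp

theorem lintegral_Iic_const_mul_exp (c k t : ℝ) (hc : 0 ≤ c) (hk : 0 < k) :
    ∫⁻ x in Set.Iic t, ENNReal.ofReal (c * Real.exp (k * x)) =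
      ENNReal.ofReal (c / k * Real.exp (k * t)) := by
  have hint := (integrableOn_exp_mul_Iic hk t).const_mul c
  rw [← ofReal_integral_eq_lintegral_ofReal hint (ae_of_all _ fun x => by positivity),
    integral_const_mul, integral_exp_mul_Iic hk t]
  congr 1
  field_simp

theorem laplace_Ioi_of_nonneg (ε t : ℝ) (hε : 0 < ε) (ht : 0 ≤ t) :
    (volume : Measure ℝ).withDensity
        (fun z => ENNReal.ofReal ((ε / 2) * Real.exp (-(ε * |z|)))) (Set.Ioi t) =
      ENNReal.ofReal (Real.exp (-(ε * t)) / 2) := by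
  rw [withDensity_apply _ measurableSet_Ioi]
  have h : ∀ z ∈ Set.Ioi t, ENNReal.ofReal ((ε / 2) * Real.exp (-(ε * |z|))) =
      ENNReal.ofReal ((ε / 2) * Real.exp (-(ε * z))) := fun z hz => by
    rw [abs_of_nonneg (ht.trans (le_of_lt hz))]
  rw [setLIntegral_congr_fun measurableSet_Ioi h,
    lintegral_Ioi_const_mul_exp_neg _ _ _ (by positivity) hε]
  congr 1
  field_simp

theorem lintegral_laplace_Ioi_add_le (ε T : ℝ) (hε : 0 < ε) (hT : 0 ≤ T) (μ : Measure ℝ)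
    [IsProbabilityMeasure μ]
    (hμ : μ = (volume : Measure ℝ).withDensity
      fun z => ENNReal.ofReal ((ε / 2) * Real.exp (-(ε * |z|)))) :
    ∫⁻ y, μ (Set.Ioi (T + y)) ∂μ ≤
      ENNReal.ofReal ((5 / 8 + ε * T / 4) * Real.exp (-(ε * T))) := by
  have hdens : Measurable fun z : ℝ => ENNReal.ofReal ((ε / 2) * Real.exp (-(ε * |z|))) := by
    fun_prop
  have htail : Measurable fun y => μ (Set.Ioi (T + y)) :=
    Antitone.measurable fun a b hab => measure_mono (Set.Ioi_subset_Ioi (by linarith))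
  have hexp : ∫⁻ y, μ (Set.Ioi (T + y)) ∂μ =
      ∫⁻ y, ENNReal.ofReal ((ε / 2) * Real.exp (-(ε * |y|))) * μ (Set.Ioi (T + y)) := by
    conv_lhs => rw [hμ]
    rw [lintegral_withDensity_eq_lintegral_mul _ hdens (by rwa [← hμ]), ← hμ]
    rfl
  have hG : ∀ y, -T ≤ y →
      μ (Set.Ioi (T + y)) = ENNReal.ofReal (Real.exp (-(ε * (T + y))) / 2) := fun y hy => by
    rw [hμ]
    exact laplace_Ioi_of_nonneg ε _ hε (by linarith)
  have hsplit : (Set.univ : Set ℝ) = Set.Iic (-T) ∪ (Set.Ioc (-T) 0 ∪ Set.Ioi 0) := by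
    rw [Set.Ioc_union_Ioi_eq_Ioi (by linarith), Set.Iic_union_Ioi]
  rw [hexp, ← setLIntegral_univ, hsplit]
  have hleft : ∫⁻ y in Set.Iic (-T),
      ENNReal.ofReal ((ε / 2) * Real.exp (-(ε * |y|))) * μ (Set.Ioi (T + y)) ≤
      ENNReal.ofReal (Real.exp (-(ε * T)) / 2) := by
    calc _ ≤ ∫⁻ y in Set.Iic (-T), ENNReal.ofReal ((ε / 2) * Real.exp (ε * y)) := by
          refine setLIntegral_mono' measurableSet_Iic fun y hy => ?_
          rw [Set.mem_Iic] at hy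
          rw [abs_of_nonpos (by linarith), mul_neg, neg_neg]
          exact mul_le_of_le_one_right' prob_le_one
      _ = _ := by
          rw [lintegral_Iic_const_mul_exp _ _ _ (by positivity) hε, mul_neg]
          congr 1
          field_simp
  have hmid : ∫⁻ y in Set.Ioc (-T) 0,
      ENNReal.ofReal ((ε / 2) * Real.exp (-(ε * |y|))) * μ (Set.Ioi (T + y)) ≤
      ENNReal.ofReal (ε * T / 4 * Real.exp (-(ε * T))) := by
    have h : ∀ y ∈ Set.Ioc (-T) 0,
        ENNReal.ofReal ((ε / 2) * Real.exp (-(ε * |y|))) * μ (Set.Ioi (T + y)) =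
        ENNReal.ofReal (ε / 4 * Real.exp (-(ε * T))) := fun y hy => by
      rw [hG y hy.1.le, ← ENNReal.ofReal_mul (by positivity), abs_of_nonpos hy.2]
      congr 1
      rw [show -(ε * T) = -(ε * -y) + -(ε * (T + y)) by ring, Real.exp_add]
      ring
    rw [setLIntegral_congr_fun measurableSet_Ioc h, setLIntegral_const, Real.volume_Ioc,
      ← ENNReal.ofReal_mul (by positivity)]
    apply le_of_eq
    congr 1
    ring
  have hright : ∫⁻ y in Set.Ioi (0 : ℝ),
      ENNReal.ofReal ((ε / 2) * Real.exp (-(ε * |y|))) * μ (Set.Ioi (T + y)) ≤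
      ENNReal.ofReal (Real.exp (-(ε * T)) / 8) := by
    have h : ∀ y ∈ Set.Ioi (0 : ℝ),
        ENNReal.ofReal ((ε / 2) * Real.exp (-(ε * |y|))) * μ (Set.Ioi (T + y)) =
        ENNReal.ofReal (ε / 4 * Real.exp (-(ε * T)) * Real.exp (-(2 * ε * y))) := fun y hy => by
      rw [Set.mem_Ioi] at hy
      rw [hG y (by linarith), ← ENNReal.ofReal_mul (by positivity), abs_of_pos hy]
      congr 1
      rw [show -(ε * (T + y)) = -(ε * T) + -(ε * y) by ring,
        show -(2 * ε * y) = -(ε * y) + -(ε * y) by ring, Real.exp_add, Real.exp_add]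
      ring
    rw [setLIntegral_congr_fun measurableSet_Ioi h,
      lintegral_Ioi_const_mul_exp_neg _ _ _ (by positivity) (by positivity)]
    apply le_of_eq
    congr 1
    simp only [mul_zero, neg_zero, Real.exp_zero]
    field_simp
    norm_num
  refine (lintegral_union_le _ _ _).trans
    ((add_le_add hleft ((lintegral_union_le _ _ _).trans (add_le_add hmid hright))).trans ?_)
  rw [← ENNReal.ofReal_add (by positivity) (by positivity),
    ← ENNReal.ofReal_add (by positivity) (by positivity)]
  apply le_of_eq
  congr 1
  ring

open MeasureTheory

/-- Lemma 22 / Lemma 29 (Laplace tail bound): if `X` and `Y` are independent Laplace(1/ε)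
random variables and `T = ln(Δ/δ)/ε`, then
`Pr[X > T + Y] ≤ 3δ/(4Δ) + δ·ln(Δ/δ)/(4Δ)`. -/
theorem stmt_13 {Ω : Type*} [MeasurableSpace Ω] (ℙ : Measure Ω) [IsProbabilityMeasure ℙ]
    (ε Δ δ : ℝ) (hε : 0 < ε) (hΔ : 1 ≤ Δ) (hδ : 0 < δ) (hδΔ : δ ≤ Δ)
    (X Y : Ω → ℝ) (hX : Measurable X) (hY : Measurable Y)
    (hindep : ProbabilityTheory.IndepFun X Y ℙ)
    (hlawX : Measure.map X ℙ =
      (volume : Measure ℝ).withDensity fun z => ENNReal.ofReal ((ε / 2) * Real.exp (-(ε * |z|))))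
    (hlawY : Measure.map Y ℙ =
      (volume : Measure ℝ).withDensity fun z => ENNReal.ofReal ((ε / 2) * Real.exp (-(ε * |z|)))) :
    ℙ {ω | X ω > Real.log (Δ / δ) / ε + Y ω} ≤
      ENNReal.ofReal (3 * δ / (4 * Δ) + δ * Real.log (Δ / δ) / (4 * Δ)) := by
  have hT : 0 ≤ Real.log (Δ / δ) := Real.log_nonneg ((one_le_div hδ).2 hδΔ)
  have hΔ0 : 0 < Δ := by linarith
  have : IsProbabilityMeasure (Measure.map X ℙ) :=
    Measure.isProbabilityMeasure_map hX.aemeasurable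
  have hS : MeasurableSet {p : ℝ × ℝ | Real.log (Δ / δ) / ε + p.2 < p.1} :=
    measurableSet_lt (by fun_prop) (by fun_prop)
  have hprob : ℙ {ω | X ω > Real.log (Δ / δ) / ε + Y ω} =
      ∫⁻ y, Measure.map X ℙ (Set.Ioi (Real.log (Δ / δ) / ε + y)) ∂(Measure.map X ℙ) := by
    have h := (ProbabilityTheory.indepFun_iff_map_prod_eq_prod_map_map
      hX.aemeasurable hY.aemeasurable).1 hindep
    rw [hlawY.trans hlawX.symm] at h
    have h2 := congrArg (fun m => m {p : ℝ × ℝ | Real.log (Δ / δ) / ε + p.2 < p.1}) h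
    simp only [Measure.map_apply (hX.prodMk hY) hS, Measure.prod_apply_symm hS] at h2
    exact h2
  rw [hprob]
  refine (lintegral_laplace_Ioi_add_le ε _ hε (by positivity) _ hlawX).trans
    (ENNReal.ofReal_le_ofReal ?_)
  rw [mul_div_cancel₀ _ hε.ne', Real.exp_neg, Real.exp_log (by positivity), inv_div]
  have hpos : 0 < δ / Δ := by positivity
  have heq : 3 * δ / (4 * Δ) + δ * Real.log (Δ / δ) / (4 * Δ) =
      (3 / 4 + Real.log (Δ / δ) / 4) * (δ / Δ) := by
    field_simp
  rw [heq]
  exact mul_le_mul_of_nonneg_right (by linarith) hpos.le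
end
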